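/- Let G=(V,E) be a finite simple graph on n vertices having at least one edge, and let λ_n(G) be the largest eigenvalue of its Laplacian. Then the homological connectivity of the independence complex satisfies η(I(G)) ≥ n/λ_n(G). -/

import Mathlib

open Finset
open scoped ENNReal
/-- An ordered tuple of vertices spans a simplex of the flag complex `X(G)`
iff its entries are pairwise adjacent. -/
def SimpleGraph.IsFlagSimplex {V : Type*} (G : SimpleGraph V) {m : ℕ} (σ : Fin m → V) : Prop :=
  ∀ i j : Fin m, i ≠ j → G.Adj (σ i) (σ j)

/-- A (real) simplicial cochain of `X(G)` in degree `m - 1`: a skew-symmetric function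
on ordered `m`-tuples of vertices, supported on the ordered simplices of `X(G)`.
(For `m = 0` this is the augmented degree `-1` part, a copy of `ℝ`.) -/
def SimpleGraph.IsFlagCochain {V : Type*} (G : SimpleGraph V) {m : ℕ}
    (φ : (Fin m → V) → ℝ) : Prop :=
  (∀ σ : Fin m → V, ¬ G.IsFlagSimplex σ → φ σ = 0) ∧
  (∀ (σ : Fin m → V) (π : Equiv.Perm (Fin m)),
    φ (σ ∘ π) = ((Equiv.Perm.sign π : ℤ) : ℝ) * φ σ)

open scoped Classical in
/-- The simplicial coboundary operator `d` of the flag complex `X(G)`: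
`(dφ)(σ) = ∑ i, (-1)^i φ(σ with i-th entry removed)` for an ordered simplex `σ`. -/
noncomputable def SimpleGraph.coboundary {V : Type*} (G : SimpleGraph V) {m : ℕ}
    (φ : (Fin m → V) → ℝ) : (Fin (m + 1) → V) → ℝ :=
  fun σ =>
    if G.IsFlagSimplex σ then
      ∑ i : Fin (m + 1), (-1 : ℝ) ^ (i : ℕ) * φ (σ ∘ i.succAbove)
    else 0
/-- Vanishing of the reduced cohomology `H̃^k(X(G); ℝ)`: every `k`-cocycle is a coboundary
(for `k = 0`, degree `-1` cochains are the constants, giving *reduced* cohomology). -/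
def SimpleGraph.flagCohomologyVanishes {V : Type*} (G : SimpleGraph V) (k : ℕ) : Prop :=
  ∀ φ : (Fin (k + 1) → V) → ℝ, G.IsFlagCochain φ → G.coboundary φ = 0 →
    ∃ ψ : (Fin k → V) → ℝ, G.IsFlagCochain ψ ∧ G.coboundary ψ = φ
/-- The homological connectivity `η(I(G)) = min{ i : H̃^i(I(G);ℝ) ≠ 0 } + 1 ∈ ℕ∞`
of the independence complex `I(G) = X(Gᶜ)` (`= ⊤` if all reduced cohomology vanishes). -/
noncomputable def SimpleGraph.indepEta {V : Type*} (G : SimpleGraph V) : ℕ∞ :=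
  sInf {i : ℕ∞ | ∃ k : ℕ, (k : ℕ∞) = i ∧ ¬ (Gᶜ).flagCohomologyVanishes k} + 1
open scoped Classical in
/-- The eigenvalues `0 = λ_1(G) ≤ λ_2(G) ≤ ⋯ ≤ λ_n(G)` of the Laplacian matrix of `G`,
listed in nondecreasing order (with multiplicity). -/
noncomputable def SimpleGraph.sortedLapEigenvalues {V : Type*} [Fintype V] [DecidableEq V]
    (G : SimpleGraph V) : List ℝ :=
  List.insertionSort (· ≤ ·)
    (List.ofFn (SimpleGraph.posSemidef_lapMatrix ℝ G).isHermitian.eigenvalues₀)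
/-- `λ_n(G)`, the largest Laplacian eigenvalue. -/
noncomputable def SimpleGraph.lambdaMax {V : Type*} [Fintype V] [DecidableEq V]
    (G : SimpleGraph V) : ℝ :=
  G.sortedLapEigenvalues.getD (Fintype.card V - 1) 0

/-- A real function of ordered tuples that changes by the sign under permutations. -/
def IsSkewFun {V : Type*} {m : ℕ} (φ : (Fin m → V) → ℝ) : Prop :=
  ∀ (σ : Fin m → V) (π : Equiv.Perm (Fin m)),
    φ (σ ∘ π) = ((Equiv.Perm.sign π : ℤ) : ℝ) * φ σ

/-- The alternating sum of the values of a function on the faces of a tuple. -/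
def altFaceSum {V : Type*} {m : ℕ} (ψ : (Fin m → V) → ℝ) (σ : Fin (m + 1) → V) : ℝ :=
  ∑ i : Fin (m + 1), (-1 : ℝ) ^ (i : ℕ) * ψ (σ ∘ i.succAbove)

lemma IsSkewFun.insertNth {V : Type*} {m : ℕ} {φ : (Fin (m + 1) → V) → ℝ} (hφ : IsSkewFun φ)
    (i : Fin (m + 1)) (v : V) (τ : Fin m → V) :
    φ (i.insertNth v τ) = (-1) ^ (i : ℕ) * φ (Fin.cons v τ) := by
  have h := hφ (Fin.cons v τ) i.cycleRange
  rw [Fin.cons_comp_cycleRange] at h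
  simpa using h

lemma IsSkewFun.cons {V : Type*} {m : ℕ} {φ : (Fin (m + 1) → V) → ℝ} (hφ : IsSkewFun φ) (v : V) :
    IsSkewFun fun τ : Fin m → V ↦ φ (Fin.cons v τ) := by
  intro τ π
  have h := hφ (Fin.cons v τ) (Equiv.Perm.decomposeFin.symm (0, π))
  have hc : (Fin.cons v τ : Fin (m + 1) → V) ∘ Equiv.Perm.decomposeFin.symm (0, π) =
      Fin.cons v (τ ∘ π) := by
    ext j
    cases j using Fin.cases <;> simp
  rw [Equiv.Perm.decomposeFin.symm_sign, hc] at h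
  simpa using h

lemma sum_tuple_insertNth {V : Type*} [Fintype V] {m : ℕ} (i : Fin (m + 1))
    (F : (Fin (m + 1) → V) → ℝ) :
    ∑ σ, F σ = ∑ τ : Fin m → V, ∑ v : V, F (i.insertNth v τ) := by
  rw [← (Fin.insertNthEquiv (fun _ ↦ V) i).sum_comp, Fintype.sum_prod_type, Finset.sum_comm]
  rfl

/-- The adjoint of the alternating face sum, on skew functions, contracts the first entry. -/
lemma IsSkewFun.sum_mul_altFaceSum {V : Type*} [Fintype V] {m : ℕ} {h : (Fin (m + 1) → V) → ℝ}
    (hh : IsSkewFun h) (ψ : (Fin m → V) → ℝ) :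
    ∑ σ, h σ * altFaceSum ψ σ = (m + 1) * ∑ τ : Fin m → V, ψ τ * ∑ v : V, h (Fin.cons v τ) := by
  have key (i : Fin (m + 1)) : ∑ σ, h σ * ((-1 : ℝ) ^ (i : ℕ) * ψ (σ ∘ i.succAbove)) =
      ∑ τ : Fin m → V, ψ τ * ∑ v : V, h (Fin.cons v τ) := by
    rw [sum_tuple_insertNth i]
    refine Finset.sum_congr rfl fun τ _ ↦ ?_
    rw [Finset.mul_sum]
    refine Finset.sum_congr rfl fun v _ ↦ ?_
    have hτ : (i.insertNth v τ : Fin (m + 1) → V) ∘ i.succAbove = τ := by ext j; simp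
    have hs : ((-1 : ℝ) ^ (i : ℕ)) * (-1) ^ (i : ℕ) = 1 := by
      rw [← mul_pow]; simp
    rw [hτ, hh.insertNth]
    linear_combination (h (Fin.cons v τ) * ψ τ) * hs
  simp only [altFaceSum, Finset.mul_sum (s := (Finset.univ : Finset (Fin (m + 1))))]
  rw [Finset.sum_comm, Finset.sum_congr rfl fun i _ ↦ key i]
  simp

lemma IsSkewFun.sum_sq_mul_sum {V : Type*} [Fintype V] {m : ℕ} {φ : (Fin (m + 1) → V) → ℝ}
    (hφ : IsSkewFun φ) (g : V → ℝ) :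
    ∑ σ, φ σ ^ 2 * ∑ i, g (σ i) =
      (m + 1) * ∑ τ : Fin m → V, ∑ v : V, g v * φ (Fin.cons v τ) ^ 2 := by
  have key (i : Fin (m + 1)) : ∑ σ, φ σ ^ 2 * g (σ i) =
      ∑ τ : Fin m → V, ∑ v : V, g v * φ (Fin.cons v τ) ^ 2 := by
    rw [sum_tuple_insertNth i]
    refine Finset.sum_congr rfl fun τ _ ↦ Finset.sum_congr rfl fun v _ ↦ ?_
    have hs : (((-1 : ℝ) ^ (i : ℕ))) ^ 2 = 1 := by
      rw [← pow_mul, mul_comm, pow_mul]; simp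
    rw [hφ.insertNth, mul_pow, hs, Fin.insertNth_apply_same]
    ring
  simp only [Finset.mul_sum (s := (Finset.univ : Finset (Fin (m + 1))))]
  rw [Finset.sum_comm, Finset.sum_congr rfl fun i _ ↦ key i]
  simp

/-- Removing the `i`-th entry of a permuted tuple permutes the tuple with entry `π i` removed. -/
lemma exists_perm_comp_succAbove {m : ℕ} (π : Equiv.Perm (Fin (m + 1))) (i : Fin (m + 1)) :
    ∃ ρ : Equiv.Perm (Fin m), π ∘ i.succAbove = (π i).succAbove ∘ ρ ∧
      Equiv.Perm.sign ρ = (-1) ^ (i : ℕ) * (-1) ^ (π i : ℕ) * Equiv.Perm.sign π := by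
  obtain ⟨⟨p, ρ⟩, hρ⟩ := Equiv.Perm.decomposeFin.symm.surjective
    ((π i).cycleRange * π * i.cycleRange⁻¹)
  have hp : p = 0 := by
    have := congrArg (fun e : Equiv.Perm (Fin (m + 1)) ↦ e 0) hρ
    simpa [Equiv.Perm.inv_def] using this
  subst hp
  refine ⟨ρ, ?_, ?_⟩
  · ext1 j
    have := congrArg (fun e : Equiv.Perm (Fin (m + 1)) ↦ e j.succ) hρ
    apply (π i).cycleRange.injective
    simpa [Equiv.Perm.inv_def] using this.symm
  · have := congrArg Equiv.Perm.sign hρ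
    rw [Equiv.Perm.decomposeFin.symm_sign] at this
    simp only [if_true, one_mul, map_mul, map_inv, Fin.sign_cycleRange] at this
    rw [this, Int.units_inv_eq_self]
    ac_rfl

lemma IsSkewFun.isSkewFun_altFaceSum {V : Type*} {m : ℕ} {ψ : (Fin m → V) → ℝ} (hψ : IsSkewFun ψ) :
    IsSkewFun (altFaceSum ψ) := by
  intro σ π
  rw [altFaceSum, altFaceSum,
    ← Equiv.sum_comp π fun i : Fin (m + 1) ↦ (-1 : ℝ) ^ (i : ℕ) * ψ (σ ∘ i.succAbove), Finset.mul_sum]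
  refine Finset.sum_congr rfl fun i _ ↦ ?_
  obtain ⟨ρ, hρ, hs⟩ := exists_perm_comp_succAbove π i
  rw [Function.comp_assoc, hρ, ← Function.comp_assoc, hψ, hs]
  have hi : ((-1 : ℝ) ^ (i : ℕ)) * (-1) ^ (i : ℕ) = 1 := by
    rw [← mul_pow]; simp
  push_cast
  linear_combination ((-1) ^ (π i : ℕ) * ((Equiv.Perm.sign π : ℤ) : ℝ) *
    ψ (σ ∘ (π i).succAbove)) * hi

lemma altFaceSum_altFaceSum {V : Type*} {m : ℕ} (ψ : (Fin m → V) → ℝ) (σ : Fin (m + 2) → V) :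
    altFaceSum (altFaceSum ψ) σ = 0 := by
  simp only [altFaceSum, Finset.mul_sum]
  rw [← Finset.sum_product']
  refine Finset.sum_involution (fun p _ ↦ (p.1.succAbove p.2, p.2.predAbove p.1)) ?_ ?_ ?_ ?_
  · rintro ⟨i, j⟩ -
    have hσ : (σ ∘ (i.succAbove j).succAbove) ∘ (j.predAbove i).succAbove =
        (σ ∘ i.succAbove) ∘ j.succAbove := by
      ext k
      simp [Fin.succAbove_succAbove_succAbove_predAbove]
    have hs := Fin.neg_one_pow_succAbove_add_predAbove (R := ℝ) i j
    rw [pow_add, pow_add] at hs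
    dsimp only
    rw [hσ]
    linear_combination ψ ((σ ∘ i.succAbove) ∘ j.succAbove) * hs
  · rintro ⟨i, j⟩ - - h
    exact Fin.succAbove_ne i j (congrArg Prod.fst h)
  · simp
  · rintro p -
    simp [Fin.succAbove_succAbove_predAbove, Fin.predAbove_predAbove_succAbove]

namespace SimpleGraph

variable {V : Type*} {H : SimpleGraph V}

lemma isFlagSimplex_cons {m : ℕ} {v : V} {τ : Fin m → V} :
    H.IsFlagSimplex (Fin.cons v τ : Fin (m + 1) → V) ↔
      (∀ i, H.Adj v (τ i)) ∧ H.IsFlagSimplex τ := by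
  simp only [IsFlagSimplex, Fin.forall_fin_succ, Fin.cons_zero, Fin.cons_succ, ne_eq,
    Fin.succ_inj, not_true_eq_false, false_imp_iff, true_and, Fin.succ_ne_zero,
    not_false_eq_true, forall_true_left, (Fin.succ_ne_zero _).symm]
  simp only [H.adj_comm v, forall_and]
  tauto

lemma IsFlagSimplex.comp_injective {m l : ℕ} {σ : Fin m → V} (hσ : H.IsFlagSimplex σ)
    {f : Fin l → Fin m} (hf : Function.Injective f) : H.IsFlagSimplex (σ ∘ f) :=
  fun _ _ hij ↦ hσ _ _ (hf.ne hij)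

lemma IsFlagCochain.isSkewFun {m : ℕ} {φ : (Fin m → V) → ℝ} (hφ : H.IsFlagCochain φ) :
    IsSkewFun φ := hφ.2

lemma coboundary_apply {m : ℕ} (φ : (Fin m → V) → ℝ) {σ : Fin (m + 1) → V}
    (hσ : H.IsFlagSimplex σ) : H.coboundary φ σ = altFaceSum φ σ := by
  simp [coboundary, altFaceSum, hσ]

lemma coboundary_apply_of_not {m : ℕ} (φ : (Fin m → V) → ℝ) {σ : Fin (m + 1) → V}
    (hσ : ¬ H.IsFlagSimplex σ) : H.coboundary φ σ = 0 := by
  simp [coboundary, hσ]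

lemma coboundary_add {m : ℕ} (φ ψ : (Fin m → V) → ℝ) :
    H.coboundary (φ + ψ) = H.coboundary φ + H.coboundary ψ := by
  ext σ
  by_cases hσ : H.IsFlagSimplex σ
  · simp [coboundary, hσ, mul_add, Finset.sum_add_distrib]
  · simp [coboundary, hσ]

lemma coboundary_smul {m : ℕ} (c : ℝ) (φ : (Fin m → V) → ℝ) :
    H.coboundary (c • φ) = c • H.coboundary φ := by
  ext σ
  by_cases hσ : H.IsFlagSimplex σ
  · simp [coboundary, hσ, Finset.mul_sum, mul_left_comm]
  · simp [coboundary, hσ]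

lemma coboundary_coboundary {m : ℕ} (ψ : (Fin m → V) → ℝ) :
    H.coboundary (H.coboundary ψ) = 0 := by
  ext σ
  by_cases hσ : H.IsFlagSimplex σ
  · rw [coboundary_apply _ hσ, Pi.zero_apply, ← altFaceSum_altFaceSum ψ σ]
    refine Finset.sum_congr rfl fun i _ ↦ ?_
    rw [coboundary_apply _ (hσ.comp_injective Fin.succAbove_right_injective)]
  · exact coboundary_apply_of_not _ hσ

lemma IsFlagCochain.add {m : ℕ} {φ ψ : (Fin m → V) → ℝ} (hφ : H.IsFlagCochain φ)
    (hψ : H.IsFlagCochain ψ) : H.IsFlagCochain (φ + ψ) :=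
  ⟨fun σ hσ ↦ by simp [hφ.1 σ hσ, hψ.1 σ hσ],
    fun σ π ↦ by simp [hφ.2 σ π, hψ.2 σ π, mul_add]⟩

lemma IsFlagCochain.smul {m : ℕ} {φ : (Fin m → V) → ℝ} (c : ℝ) (hφ : H.IsFlagCochain φ) :
    H.IsFlagCochain (c • φ) :=
  ⟨fun σ hσ ↦ by simp [hφ.1 σ hσ], fun σ π ↦ by simp [hφ.2 σ π, mul_left_comm]⟩

lemma isFlagSimplex_comp_perm {m : ℕ} {σ : Fin m → V} (π : Equiv.Perm (Fin m)) :
    H.IsFlagSimplex (σ ∘ π) ↔ H.IsFlagSimplex σ :=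
  ⟨fun h ↦ by simpa [Function.comp_assoc] using h.comp_injective π.symm.injective,
    fun h ↦ h.comp_injective π.injective⟩

lemma IsFlagCochain.coboundary {m : ℕ} {ψ : (Fin m → V) → ℝ} (hψ : H.IsFlagCochain ψ) :
    H.IsFlagCochain (H.coboundary ψ) := by
  refine ⟨fun σ hσ ↦ coboundary_apply_of_not _ hσ, fun σ π ↦ ?_⟩
  by_cases hσ : H.IsFlagSimplex σ
  · rw [coboundary_apply _ hσ, coboundary_apply _ ((isFlagSimplex_comp_perm π).mpr hσ)]
    exact hψ.isSkewFun.isSkewFun_altFaceSum σ π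
  · rw [coboundary_apply_of_not _ hσ,
      coboundary_apply_of_not _ (mt (isFlagSimplex_comp_perm π).mp hσ), mul_zero]

lemma isFlagCochain_zero {m : ℕ} : H.IsFlagCochain (0 : (Fin m → V) → ℝ) :=
  ⟨fun _ _ ↦ rfl, fun _ _ ↦ by simp⟩

end SimpleGraph

namespace SimpleGraph

variable {V : Type*} [Fintype V] {H : SimpleGraph V}

open scoped Classical in
/-- A nonvanishing reduced cohomology group contains a nonzero harmonic cochain. -/
lemma exists_harmonic_of_not_flagCohomologyVanishes {k : ℕ} (hk : ¬ H.flagCohomologyVanishes k) :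
    ∃ φ : (Fin (k + 1) → V) → ℝ, φ ≠ 0 ∧ H.IsFlagCochain φ ∧ H.coboundary φ = 0 ∧
      ∀ τ : Fin k → V, ∑ v, φ (Fin.cons v τ) = 0 := by
  simp only [flagCohomologyVanishes, not_forall] at hk
  obtain ⟨φ, hφ, hdφ, hne⟩ := hk
  let B : Submodule ℝ (EuclideanSpace ℝ (Fin (k + 1) → V)) :=
    { carrier := {x | ∃ ψ : (Fin k → V) → ℝ, H.IsFlagCochain ψ ∧ H.coboundary ψ = x.ofLp}
      add_mem' := by
        rintro x y ⟨ψ, hψ, hx⟩ ⟨χ, hχ, hy⟩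
        exact ⟨ψ + χ, hψ.add hχ, by rw [coboundary_add, hx, hy]; rfl⟩
      zero_mem' := ⟨0, isFlagCochain_zero, by
        have := coboundary_smul (H := H) 0 (0 : (Fin k → V) → ℝ)
        simpa using this⟩
      smul_mem' := by
        rintro c x ⟨ψ, hψ, hx⟩
        exact ⟨c • ψ, hψ.smul c, by rw [coboundary_smul, hx]; rfl⟩ }
  obtain ⟨b, ⟨ψ, hψ, hb⟩, h, hh, hsum⟩ :=
    B.exists_add_mem_mem_orthogonal (WithLp.toLp 2 φ)
  have hφbh : h.ofLp = φ + (-1 : ℝ) • H.coboundary ψ := by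
    have := congrArg WithLp.ofLp hsum
    rw [hb]
    ext σ
    have := congrFun this σ
    simp at this ⊢
    linarith
  have hg : H.IsFlagCochain h.ofLp := hφbh ▸ hφ.add (hψ.coboundary.smul _)
  refine ⟨h.ofLp, fun h0 ↦ hne ⟨ψ, hψ, ?_⟩, hg, ?_, ?_⟩
  · rw [h0] at hφbh
    ext σ
    have := congrFun hφbh σ
    simp at this
    linarith
  · rw [hφbh, coboundary_add, coboundary_smul, coboundary_coboundary, hdφ]
    simp
  · let χ : (Fin k → V) → ℝ := fun τ ↦ ∑ v, h.ofLp (Fin.cons v τ)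
    have hχ : H.IsFlagCochain χ := by
      refine ⟨fun τ hτ ↦ Finset.sum_eq_zero fun v _ ↦
        hg.1 _ fun hc ↦ hτ (isFlagSimplex_cons.mp hc).2, fun τ π ↦ ?_⟩
      simp only [χ, Finset.mul_sum]
      exact Finset.sum_congr rfl fun v _ ↦ hg.isSkewFun.cons v τ π
    have horth := (B.mem_orthogonal h).mp hh (WithLp.toLp 2 (H.coboundary χ)) ⟨χ, hχ, rfl⟩
    have hsum0 : ∑ σ, h.ofLp σ * altFaceSum χ σ = 0 := by
      rw [← horth, PiLp.inner_apply]
      refine Finset.sum_congr rfl fun σ _ ↦ ?_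
      by_cases hσ : H.IsFlagSimplex σ
      · simp [coboundary_apply _ hσ]
      · simp [hg.1 σ hσ]
    rw [hg.isSkewFun.sum_mul_altFaceSum] at hsum0
    have hsq : ∑ τ, χ τ * χ τ = 0 :=
      (mul_eq_zero.mp hsum0).resolve_left (by positivity)
    intro τ
    exact mul_self_eq_zero.mp
      ((Finset.sum_eq_zero_iff_of_nonneg fun τ _ ↦ mul_self_nonneg (χ τ)).mp hsq τ
        (Finset.mem_univ τ))

open scoped Classical in
/-- On each tuple, the closed non-neighbourhoods of the entries together with the common
neighbourhood cover the vertex set. -/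
lemma card_le_sum_nonadj_add_common {m : ℕ} (σ : Fin m → V) :
    (Fintype.card V : ℝ) ≤ ∑ i, ∑ w, (1 - if H.Adj (σ i) w then (1 : ℝ) else 0) +
      ∑ v, if ∀ i, H.Adj v (σ i) then (1 : ℝ) else 0 := by
  rw [Finset.sum_comm, ← Finset.sum_add_distrib, Fintype.card_eq_sum_ones, Nat.cast_sum]
  refine Finset.sum_le_sum fun w _ ↦ ?_
  have hnn (i : Fin m) : 0 ≤ 1 - if H.Adj (σ i) w then (1 : ℝ) else 0 := by
    split_ifs <;> simp
  by_cases h : ∀ i, H.Adj w (σ i)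
  · rw [if_pos h]
    simpa only [Nat.cast_one, le_add_iff_nonneg_left] using Finset.sum_nonneg fun i _ ↦ hnn i
  · obtain ⟨i, hi⟩ := not_forall.mp h
    have := Finset.single_le_sum (fun i _ ↦ hnn i) (Finset.mem_univ i)
    simpa [h, H.adj_comm (σ i), hi] using this

open scoped Classical in
/-- For a cocycle, the mass carried by common neighbours is an off-diagonal sum. -/
lemma IsFlagCochain.sum_common_mul_sq {k : ℕ} {φ : (Fin (k + 1) → V) → ℝ}
    (hφ : H.IsFlagCochain φ) (hd : H.coboundary φ = 0) (v : V) :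
    ∑ σ, φ σ ^ 2 * (if ∀ i, H.Adj v (σ i) then (1 : ℝ) else 0) =
      (k + 1) * ∑ τ : Fin k → V, φ (Fin.cons v τ) *
        ∑ w, (if H.Adj v w then (1 : ℝ) else 0) * φ (Fin.cons w τ) := by
  let h : (Fin (k + 1) → V) → ℝ := fun σ ↦ (if ∀ i, H.Adj v (σ i) then (1 : ℝ) else 0) * φ σ
  have hh : IsSkewFun h := by
    intro σ π
    have : (∀ i, H.Adj v ((σ ∘ π) i)) ↔ ∀ i, H.Adj v (σ i) :=
      ⟨fun H i ↦ by simpa using H (π.symm i), fun H i ↦ H _⟩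
    simp only [h, this, hφ.2 σ π]
    ring
  have hadj := hh.sum_mul_altFaceSum fun τ ↦ φ (Fin.cons v τ)
  have hface (σ : Fin (k + 1) → V) (hσ : H.IsFlagSimplex (Fin.cons v σ : Fin (k + 2) → V)) :
      altFaceSum (fun τ ↦ φ (Fin.cons v τ)) σ = φ σ := by
    have h0 := congrFun hd (Fin.cons v σ)
    rw [coboundary_apply _ hσ, altFaceSum, Fin.sum_univ_succ] at h0
    have hc (i : Fin (k + 1)) : (Fin.cons v σ : Fin (k + 2) → V) ∘ i.succ.succAbove =
        Fin.cons v (σ ∘ i.succAbove) := by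
      ext j
      cases j using Fin.cases <;> simp
    have hc0 : (Fin.cons v σ : Fin (k + 2) → V) ∘ (0 : Fin (k + 2)).succAbove = σ := by
      ext j; simp
    simp only [hc, hc0, Fin.val_zero, pow_zero, one_mul, Fin.val_succ, pow_succ, mul_neg, mul_one,
      neg_mul, Finset.sum_neg_distrib, Pi.zero_apply] at h0
    rw [altFaceSum]
    linarith
  trans ∑ σ, h σ * altFaceSum (fun τ ↦ φ (Fin.cons v τ)) σ
  · refine Finset.sum_congr rfl fun σ _ ↦ ?_
    by_cases hσ : (∀ i, H.Adj v (σ i)) ∧ H.IsFlagSimplex σ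
    · rw [hface σ (isFlagSimplex_cons.mpr hσ)]
      simp [h, hσ.1, sq]
    · by_cases hσ' : H.IsFlagSimplex σ
      · have : ¬ ∀ i, H.Adj v (σ i) := fun H ↦ hσ ⟨H, hσ'⟩
        simp [h, this]
      · simp [h, hφ.1 σ hσ']
  · rw [hadj]
    congr 1
    refine Finset.sum_congr rfl fun τ _ ↦ ?_
    by_cases hτ : ∀ i, H.Adj v (τ i)
    · simp [h, Fin.forall_fin_succ, hτ]
    · have : φ (Fin.cons v τ) = 0 := hφ.1 _ fun hc ↦ hτ (isFlagSimplex_cons.mp hc).1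
      simp [this]

open scoped Classical in
lemma sum_nonadj_sq_sub (f : V → ℝ) (hf : ∑ v, f v = 0) :
    ∑ v, ∑ w, (if H.Adj v w then 0 else (f v - f w) ^ 2) =
      2 * (∑ v, (∑ w, (1 - if H.Adj v w then (1 : ℝ) else 0)) * f v ^ 2 +
        ∑ v, f v * ∑ w, (if H.Adj v w then (1 : ℝ) else 0) * f w) := by
  have h1 : ∑ v, ∑ w, (1 - if H.Adj v w then (1 : ℝ) else 0) * f w ^ 2 =
      ∑ v, ∑ w, (1 - if H.Adj v w then (1 : ℝ) else 0) * f v ^ 2 := by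
    rw [Finset.sum_comm]
    simp only [H.adj_comm]
  have h2 : ∑ v, ∑ w, f v * f w = 0 := by
    simp [← Finset.mul_sum, hf]
  calc _ = ∑ v, ∑ w, (1 - if H.Adj v w then (1 : ℝ) else 0) * f v ^ 2 +
        ∑ v, ∑ w, (1 - if H.Adj v w then (1 : ℝ) else 0) * f w ^ 2 +
        2 * ∑ v, ∑ w, f v * ((if H.Adj v w then (1 : ℝ) else 0) * f w) -
        2 * ∑ v, ∑ w, f v * f w := by
        simp only [Finset.mul_sum, ← Finset.sum_add_distrib, ← Finset.sum_sub_distrib]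
        refine Finset.sum_congr rfl fun v _ ↦ Finset.sum_congr rfl fun w _ ↦ ?_
        split_ifs <;> ring
    _ = _ := by
        rw [h1, h2]
        simp only [← Finset.mul_sum, ← Finset.sum_mul]
        ring

open scoped Classical in
/-- If `Λ` bounds the Laplacian form of the complementary graph, then a nonzero harmonic
`k`-cochain forces `|V| ≤ (k + 1) Λ`. -/
lemma card_le_of_harmonic {k : ℕ} {φ : (Fin (k + 1) → V) → ℝ} {Λ : ℝ}
    (hΛ : ∀ f : V → ℝ, ∑ v, ∑ w, (if H.Adj v w then 0 else (f v - f w) ^ 2) ≤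
      2 * (Λ * ∑ v, f v ^ 2))
    (h0 : φ ≠ 0) (hφ : H.IsFlagCochain φ) (hd : H.coboundary φ = 0)
    (hδ : ∀ τ : Fin k → V, ∑ v, φ (Fin.cons v τ) = 0) :
    (Fintype.card V : ℝ) ≤ (k + 1) * Λ := by
  obtain ⟨σ₀, hσ₀⟩ := Function.ne_iff.mp h0
  have hpos : 0 < ∑ σ, φ σ ^ 2 :=
    Finset.sum_pos' (fun σ _ ↦ sq_nonneg _) ⟨σ₀, Finset.mem_univ _, sq_pos_of_ne_zero hσ₀⟩
  have hnorm : ∑ τ : Fin k → V, ∑ v, φ (Fin.cons v τ) ^ 2 = ∑ σ, φ σ ^ 2 := by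
    rw [sum_tuple_insertNth 0]
    simp
  have hlink (τ : Fin k → V) := (sum_nonadj_sq_sub (H := H) _ (hδ τ)).symm.trans_le
    (hΛ fun v ↦ φ (Fin.cons v τ))
  have htot : ∑ τ : Fin k → V,
      (∑ v, (∑ w, (1 - if H.Adj v w then (1 : ℝ) else 0)) * φ (Fin.cons v τ) ^ 2 +
        ∑ v, φ (Fin.cons v τ) *
          ∑ w, (if H.Adj v w then (1 : ℝ) else 0) * φ (Fin.cons w τ)) ≤
      Λ * ∑ σ, φ σ ^ 2 := by
    rw [← hnorm, Finset.mul_sum]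
    exact Finset.sum_le_sum fun τ _ ↦ by linarith [hlink τ]
  have hdeg := hφ.isSkewFun.sum_sq_mul_sum
    fun v ↦ ∑ w, (1 - if H.Adj v w then (1 : ℝ) else 0)
  have hcommon := Finset.sum_congr (s₁ := Finset.univ) rfl
    fun v _ ↦ hφ.sum_common_mul_sq hd v
  rw [← Finset.mul_sum, Finset.sum_comm, Finset.sum_comm (γ := V)] at hcommon
  have hcover : Fintype.card V * ∑ σ, φ σ ^ 2 ≤
      ∑ σ, φ σ ^ 2 * ∑ i, ∑ w, (1 - if H.Adj (σ i) w then (1 : ℝ) else 0) +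
      ∑ σ, ∑ v, φ σ ^ 2 * (if ∀ i, H.Adj v (σ i) then (1 : ℝ) else 0) := by
    rw [← Finset.sum_add_distrib, Finset.mul_sum]
    refine Finset.sum_le_sum fun σ _ ↦ ?_
    rw [← Finset.mul_sum, ← mul_add, mul_comm]
    exact mul_le_mul_of_nonneg_left (card_le_sum_nonadj_add_common σ) (sq_nonneg _)
  rw [hdeg, hcommon, ← mul_add, ← Finset.sum_add_distrib] at hcover
  refine le_of_mul_le_mul_right (hcover.trans ?_) hpos
  rw [mul_assoc]
  exact mul_le_mul_of_nonneg_left htot (by positivity)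

end SimpleGraph

namespace SimpleGraph

variable {V : Type*} [Fintype V] [DecidableEq V] (G : SimpleGraph V)

open scoped Classical in
lemma eigenvalues_lapMatrix_le_lambdaMax (v : V) :
    (posSemidef_lapMatrix ℝ G).isHermitian.eigenvalues v ≤ G.lambdaMax := by
  set l := G.sortedLapEigenvalues with hl
  have hlen : l.length = Fintype.card V := by
    rw [hl, sortedLapEigenvalues, List.length_insertionSort, List.length_ofFn]
  have hmem : (posSemidef_lapMatrix ℝ G).isHermitian.eigenvalues v ∈ l := by
    rw [hl, sortedLapEigenvalues, List.mem_insertionSort, List.mem_ofFn]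
    exact ⟨_, rfl⟩
  obtain ⟨i, hi, hiv⟩ := List.getElem_of_mem hmem
  have hcard : Fintype.card V - 1 < l.length := by omega
  rw [lambdaMax, ← hl, List.getD_eq_getElem _ _ hcard, ← hiv]
  have hsorted : l.SortedLE := (List.pairwise_insertionSort (· ≤ ·) _).sortedLE
  exact hsorted.monotone_get
    (show (⟨i, hi⟩ : Fin l.length) ≤ ⟨_, hcard⟩ from Fin.mk_le_mk.mpr (by omega))

open scoped Classical MatrixOrder in
lemma sum_adj_sq_sub_le (f : V → ℝ) :
    ∑ v, ∑ w, (if G.Adj v w then (f v - f w) ^ 2 else 0) ≤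
      2 * (G.lambdaMax * ∑ v, f v ^ 2) := by
  have hL := (posSemidef_lapMatrix ℝ G).isHermitian
  have hle : G.lapMatrix ℝ ≤ algebraMap ℝ (Matrix V V ℝ) G.lambdaMax := by
    refine le_algebraMap_of_spectrum_le (fun x hx ↦ ?_) hL
    rw [hL.spectrum_real_eq_range_eigenvalues] at hx
    obtain ⟨v, rfl⟩ := hx
    exact G.eigenvalues_lapMatrix_le_lambdaMax v
  have hq := (Matrix.le_iff.mp hle).dotProduct_mulVec_nonneg f
  have hform := lapMatrix_toLinearMap₂' ℝ G f
  rw [Matrix.toLinearMap₂'_apply'] at hform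
  rw [star_trivial, Matrix.sub_mulVec, dotProduct_sub, hform, Matrix.algebraMap_eq_diagonal] at hq
  simp only [dotProduct, Matrix.mulVec_diagonal, Pi.algebraMap_apply, Algebra.algebraMap_self,
    RingHom.id_apply] at hq
  have : ∑ v, f v * (G.lambdaMax * f v) = G.lambdaMax * ∑ v, f v ^ 2 := by
    rw [Finset.mul_sum]
    exact Finset.sum_congr rfl fun v _ ↦ by ring
  linarith

lemma card_le_of_not_flagCohomologyVanishes_compl {k : ℕ}
    (hk : ¬ (Gᶜ).flagCohomologyVanishes k) :
    (Fintype.card V : ℝ) ≤ (k + 1) * G.lambdaMax := by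
  classical
  obtain ⟨φ, h0, hφ, hd, hδ⟩ := exists_harmonic_of_not_flagCohomologyVanishes hk
  refine card_le_of_harmonic (fun f ↦ ?_) h0 hφ hd hδ
  refine le_trans (le_of_eq ?_) (G.sum_adj_sq_sub_le f)
  refine Finset.sum_congr rfl fun v _ ↦ Finset.sum_congr rfl fun w _ ↦ ?_
  by_cases hvw : v = w
  · simp [hvw]
  · by_cases hG : G.Adj v w <;> simp [compl_adj, hvw, hG]

end SimpleGraph

/-- **Theorem 4.1**: for a graph `G` on `n` vertices with at least one edge, the homological
connectivity of the independence complex satisfies `η(I(G)) ≥ n / λ_n(G)`, where `λ_n(G)` is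
the largest Laplacian eigenvalue. -/
theorem indepEta_ge_card_div_lambdaMax {V : Type*} [Fintype V] [DecidableEq V]
    (G : SimpleGraph V) (hE : G.edgeSet.Nonempty) :
    ENNReal.ofReal ((Fintype.card V : ℝ) / G.lambdaMax) ≤ (G.indepEta : ℝ≥0∞) := by
  rw [SimpleGraph.indepEta]
  set S := {i : ℕ∞ | ∃ k : ℕ, (k : ℕ∞) = i ∧ ¬ (Gᶜ).flagCohomologyVanishes k} with hS
  rcases S.eq_empty_or_nonempty with hempty | hne
  · simp [hempty]
  · obtain ⟨k, hk, hvan⟩ := csInf_mem hne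
    have hcard := G.card_le_of_not_flagCohomologyVanishes_compl hvan
    have hdiv : (Fintype.card V : ℝ) / G.lambdaMax ≤ ((k + 1 : ℕ) : ℝ) := by
      push_cast
      rcases le_or_gt G.lambdaMax 0 with hneg | hpos
      · exact (div_nonpos_of_nonneg_of_nonpos (Nat.cast_nonneg _) hneg).trans (by positivity)
      · rwa [div_le_iff₀ hpos]
    rw [← hk]
    refine (ENNReal.ofReal_le_ofReal hdiv).trans (le_of_eq ?_)
    rw [ENNReal.ofReal_natCast]
    simp
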